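/- Let c_j = 2^j ∫_{1/2}^{1} r^{2^{2^j}} / ( (1−r)(log(1/(1−r)))² ) dr for integers j ≥ 1. Then there exist constants 0 < c ≤ C < ∞ such that c ≤ c_j ≤ C for every j ≥ 1. -/

import Mathlib

open MeasureTheory Real Filter Set

/-- The coefficient `c_j = 2^j ∫_{1/2}^1 r^(2^(2^j)) / ((1−r) (log 1/(1−r))²) dr`. -/
noncomputable def cCoef (j : ℕ) : ℝ :=
  2 ^ j * ∫ r in (1/2 : ℝ)..1, r ^ (2 ^ (2 ^ j)) / ((1 - r) * (Real.log (1 / (1 - r))) ^ 2)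

/-- The primitive `1 / log (1 - r)` of the weight extends continuously to `r = 1`. -/
lemma continuousAt_inv_log_zero : ContinuousAt (fun x : ℝ => (Real.log x)⁻¹) 0 := by
  rw [continuousAt_iff_punctured_nhds]
  simpa [Function.comp_def] using tendsto_inv_atBot_zero.comp Real.tendsto_log_nhdsNE_zero

/-- The weight `1 / ((1 - r) (log 1/(1 - r))²)`. -/
noncomputable def logWeight (r : ℝ) : ℝ := ((1 - r) * (Real.log (1 / (1 - r))) ^ 2)⁻¹

lemma logWeight_nonneg {r : ℝ} (hr : r ≤ 1) : 0 ≤ logWeight r :=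
  inv_nonneg.2 (mul_nonneg (sub_nonneg.2 hr) (sq_nonneg _))

lemma hasDerivAt_inv_log_one_sub {r : ℝ} (h0 : 0 < r) (h1 : r < 1) :
    HasDerivAt (fun x : ℝ => (Real.log (1 - x))⁻¹) (logWeight r) r := by
  have hne : 1 - r ≠ 0 := by linarith
  have hlog : Real.log (1 - r) ≠ 0 := (Real.log_neg (by linarith) (by linarith)).ne
  have heq : logWeight r = -(-1 / (1 - r)) / Real.log (1 - r) ^ 2 := by
    simp only [logWeight, one_div, Real.log_inv]
    field_simp
  rw [heq]
  exact (((hasDerivAt_id' r).const_sub 1).log hne).inv hlog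

lemma continuousOn_inv_log_one_sub {a : ℝ} (ha : 0 < a) :
    ContinuousOn (fun x : ℝ => (Real.log (1 - x))⁻¹) (Icc a 1) := by
  intro x hx
  apply ContinuousAt.continuousWithinAt
  rcases hx.2.eq_or_lt with rfl | h
  · exact ContinuousAt.comp (g := fun x : ℝ => (Real.log x)⁻¹) (f := fun x : ℝ => 1 - x)
      (by simpa using continuousAt_inv_log_zero) (by fun_prop)
  · exact (hasDerivAt_inv_log_one_sub (ha.trans_le hx.1) h).continuousAt

lemma intervalIntegrable_logWeight {a : ℝ} (ha : 0 < a) (ha1 : a ≤ 1) :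
    IntervalIntegrable logWeight volume a 1 := by
  rw [intervalIntegrable_iff_integrableOn_Ioc_of_le ha1]
  exact intervalIntegral.integrableOn_deriv_of_nonneg (continuousOn_inv_log_one_sub ha)
    (fun x hx => hasDerivAt_inv_log_one_sub (ha.trans hx.1) hx.2)
    (fun x hx => logWeight_nonneg hx.2.le)

lemma integral_logWeight {a : ℝ} (ha : 0 < a) (ha1 : a ≤ 1) :
    ∫ r in a..1, logWeight r = (Real.log (1 - a)⁻¹)⁻¹ := by
  rw [intervalIntegral.integral_eq_sub_of_hasDerivAt_of_le ha1 (continuousOn_inv_log_one_sub ha)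
    (fun x hx => hasDerivAt_inv_log_one_sub (ha.trans hx.1) hx.2)
    (intervalIntegrable_logWeight ha ha1)]
  simp [inv_neg]

lemma intervalIntegrable_pow_mul_logWeight (n : ℕ) {a b : ℝ} (ha : 0 < a) (hab : a ≤ b)
    (hb : b ≤ 1) : IntervalIntegrable (fun r => r ^ n * logWeight r) volume a b := by
  refine IntervalIntegrable.continuousOn_mul ?_ (by fun_prop)
  refine (intervalIntegrable_logWeight ha (hab.trans hb)).mono_set ?_
  rw [uIcc_of_le hab, uIcc_of_le (hab.trans hb)]
  exact Icc_subset_Icc_right hb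

lemma pow_mul_integral_logWeight_le (n : ℕ) {a : ℝ} (ha : 1 / 2 ≤ a) (ha1 : a ≤ 1) :
    a ^ n * (Real.log (1 - a)⁻¹)⁻¹ ≤ ∫ r in (1 / 2 : ℝ)..1, r ^ n * logWeight r := by
  have ha0 : 0 < a := by linarith
  rw [← intervalIntegral.integral_add_adjacent_intervals
    (intervalIntegrable_pow_mul_logWeight n (by norm_num) ha ha1)
    (intervalIntegrable_pow_mul_logWeight n ha0 ha1 le_rfl), ← integral_logWeight ha0 ha1,
    ← intervalIntegral.integral_const_mul]
  have h1 : 0 ≤ ∫ r in (1 / 2 : ℝ)..a, r ^ n * logWeight r :=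
    intervalIntegral.integral_nonneg ha fun r hr =>
      mul_nonneg (pow_nonneg (by linarith [hr.1]) _) (logWeight_nonneg (hr.2.trans ha1))
  have h2 : ∫ r in a..1, a ^ n * logWeight r ≤ ∫ r in a..1, r ^ n * logWeight r :=
    intervalIntegral.integral_mono_on ha1 ((intervalIntegrable_logWeight ha0 ha1).const_mul _)
      (intervalIntegrable_pow_mul_logWeight n ha0 ha1 le_rfl) fun r hr =>
        mul_le_mul_of_nonneg_right (pow_le_pow_left₀ ha0.le hr.1 n) (logWeight_nonneg hr.2)
  linarith

lemma integral_pow_mul_logWeight_le (n : ℕ) {a : ℝ} (ha : 1 / 2 ≤ a) (ha1 : a ≤ 1) :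
    ∫ r in (1 / 2 : ℝ)..1, r ^ n * logWeight r ≤
      a ^ n * (Real.log 2)⁻¹ + (Real.log (1 - a)⁻¹)⁻¹ := by
  have ha0 : 0 < a := by linarith
  have hhalf : (0 : ℝ) < 1 / 2 := by norm_num
  have hw1 : IntervalIntegrable logWeight volume (1 / 2) a :=
    (by simpa using intervalIntegrable_pow_mul_logWeight 0 hhalf ha ha1)
  have hw2 := intervalIntegrable_logWeight ha0 ha1
  have htot : ∫ r in (1 / 2 : ℝ)..1, logWeight r = (Real.log 2)⁻¹ := by
    rw [integral_logWeight hhalf (by norm_num)]; norm_num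
  have hsplit := intervalIntegral.integral_add_adjacent_intervals hw1 hw2
  have hnn : 0 ≤ ∫ r in a..1, logWeight r :=
    intervalIntegral.integral_nonneg ha1 fun r hr => logWeight_nonneg hr.2
  rw [← intervalIntegral.integral_add_adjacent_intervals
    (intervalIntegrable_pow_mul_logWeight n hhalf ha ha1)
    (intervalIntegrable_pow_mul_logWeight n ha0 ha1 le_rfl), ← integral_logWeight ha0 ha1]
  have h1 : ∫ r in (1 / 2 : ℝ)..a, r ^ n * logWeight r ≤
      ∫ r in (1 / 2 : ℝ)..a, a ^ n * logWeight r :=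
    intervalIntegral.integral_mono_on ha (intervalIntegrable_pow_mul_logWeight n hhalf ha ha1)
      (hw1.const_mul _) fun r hr =>
        mul_le_mul_of_nonneg_right (pow_le_pow_left₀ (by linarith [hr.1]) hr.2 n)
          (logWeight_nonneg (hr.2.trans ha1))
  have h2 : ∫ r in a..1, r ^ n * logWeight r ≤ ∫ r in a..1, logWeight r :=
    intervalIntegral.integral_mono_on ha1
      (intervalIntegrable_pow_mul_logWeight n ha0 ha1 le_rfl) hw2 fun r hr =>
        mul_le_of_le_one_left (logWeight_nonneg hr.2)
          (pow_le_one₀ (ha0.le.trans hr.1) hr.2)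
  rw [intervalIntegral.integral_const_mul] at h1
  have h3 : a ^ n * ∫ r in (1 / 2 : ℝ)..a, logWeight r ≤ a ^ n * (Real.log 2)⁻¹ :=
    mul_le_mul_of_nonneg_left (by linarith) (by positivity)
  linarith

lemma cCoef_eq (j : ℕ) :
    cCoef j = 2 ^ j * ∫ r in (1 / 2 : ℝ)..1, r ^ (2 ^ 2 ^ j) * logWeight r := by
  simp only [cCoef, logWeight, div_eq_mul_inv]

lemma le_cCoef (j : ℕ) : 1 / (4 * Real.log 2) ≤ cCoef j := by
  have hlog : 0 < Real.log 2 := Real.log_pos one_lt_two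
  set M : ℕ := 2 ^ j with hM
  have hM1 : (1 : ℝ) ≤ M := by exact_mod_cast Nat.one_le_two_pow
  have hinv : (1 - (1 - ((2 : ℝ) ^ (M + 1))⁻¹))⁻¹ = 2 ^ (M + 1) := by simp
  have hle : ((2 : ℝ) ^ (M + 1))⁻¹ ≤ 1 / 2 := by
    rw [one_div]
    exact inv_anti₀ two_pos (le_self_pow₀ one_le_two (by simp))
  have hpow : (1 / 2 : ℝ) ≤ (1 - ((2 : ℝ) ^ (M + 1))⁻¹) ^ (2 ^ M) := by
    have h := one_add_mul_le_pow (a := -((2 : ℝ) ^ (M + 1))⁻¹) (by linarith) (2 ^ M)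
    have e : ((2 ^ M : ℕ) : ℝ) * -((2 : ℝ) ^ (M + 1))⁻¹ = -(1 / 2) := by
      push_cast
      field_simp
      ring
    rw [e, ← sub_eq_add_neg, ← sub_eq_add_neg] at h
    linarith
  have h := pow_mul_integral_logWeight_le (2 ^ M) (a := 1 - ((2 : ℝ) ^ (M + 1))⁻¹)
    (by linarith) (by simp)
  rw [hinv, Real.log_pow] at h
  have hMr : (2 : ℝ) ^ j = M := by simp [hM]
  rw [cCoef_eq, ← hM, hMr]
  calc 1 / (4 * Real.log 2) ≤ M * (1 / 2 * (((M + 1 : ℕ) : ℝ) * Real.log 2)⁻¹) := by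
        push_cast
        rw [div_le_iff₀ (by positivity)]
        field_simp
        linarith
    _ ≤ M * _ := by
        gcongr
        exact le_trans (by gcongr) h

lemma cCoef_succ_le (k : ℕ) : cCoef (k + 1) ≤ 4 / Real.log 2 := by
  have hlog : 0 < Real.log 2 := Real.log_pos one_lt_two
  set m : ℕ := 2 ^ k with hm
  have hm1 : 1 ≤ m := Nat.one_le_two_pow
  have hm0 : (0 : ℝ) < m := by exact_mod_cast hm1
  have hinv : (1 - (1 - ((2 : ℝ) ^ m)⁻¹))⁻¹ = 2 ^ m := by simp
  have hle : ((2 : ℝ) ^ m)⁻¹ ≤ 1 / 2 := by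
    rw [one_div]
    exact inv_anti₀ two_pos (le_self_pow₀ one_le_two (by omega))
  have hmK : (m : ℝ) ≤ 2 ^ m := by exact_mod_cast Nat.lt_two_pow_self.le
  have hpow : (1 - ((2 : ℝ) ^ m)⁻¹) ^ (2 ^ (2 * m)) ≤ (m : ℝ)⁻¹ := by
    calc (1 - ((2 : ℝ) ^ m)⁻¹) ^ (2 ^ (2 * m))
        ≤ Real.exp (-((2 : ℝ) ^ m)⁻¹) ^ (2 ^ (2 * m)) :=
          pow_le_pow_left₀ (by linarith) (Real.one_sub_le_exp_neg _) _
      _ = (Real.exp (2 ^ m))⁻¹ := by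
          rw [← Real.exp_nat_mul, ← Real.exp_neg]
          congr 1
          push_cast
          rw [two_mul, pow_add]
          field_simp
      _ ≤ (m : ℝ)⁻¹ := inv_anti₀ hm0 (by linarith [Real.add_one_le_exp ((2 : ℝ) ^ m)])
  have h := integral_pow_mul_logWeight_le (2 ^ (2 * m)) (a := 1 - ((2 : ℝ) ^ m)⁻¹)
    (by linarith) (by simp)
  rw [hinv, Real.log_pow] at h
  have hMr : (2 : ℝ) ^ (k + 1) = 2 * m := by simp [hm, pow_succ, mul_comm]
  have hMn : 2 ^ (k + 1) = 2 * m := by simp [hm, pow_succ, mul_comm]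
  rw [cCoef_eq, hMn, hMr]
  calc 2 * (m : ℝ) * _ ≤ 2 * m * ((m : ℝ)⁻¹ * (Real.log 2)⁻¹ + (m * Real.log 2)⁻¹) := by
        gcongr
        exact h.trans (by gcongr)
    _ = 4 / Real.log 2 := by
        field_simp
        norm_num

theorem stmt_10 :
    ∃ c C : ℝ, 0 < c ∧ c ≤ C ∧ ∀ j : ℕ, 1 ≤ j → c ≤ cCoef j ∧ cCoef j ≤ C := by
  have hlog : 0 < Real.log 2 := Real.log_pos one_lt_two
  refine ⟨1 / (4 * Real.log 2), 4 / Real.log 2, by positivity,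
    (le_cCoef 1).trans (cCoef_succ_le 0), fun j hj => ⟨le_cCoef j, ?_⟩⟩
  obtain ⟨k, rfl⟩ := Nat.exists_eq_add_of_le' hj
  exact cCoef_succ_le k
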